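/- arXiv:1506.05738 — 6 statements merged into one kernel-verified Lean document; each statement's English description precedes it below -/
import Mathlib

section
/- Let B, G, Z, W be real s×s matrices and suppose the preconsistency condition B𝟙 = 𝟙 holds, where 𝟙 = (1,…,1)ᵀ ∈ ℝ^s. Then the vector v = (𝟙ᵀ, 𝟙ᵀ)ᵀ ∈ ℝ^{2s} satisfies vᵀ𝕄v = 0 for the test matrix 𝕄 = [[GᵀZ + ZG − W, −GᵀZB], [−BᵀZG, W]]. Consequently, if 𝕄 is positive semidefinite, then 𝕄v = 0, so 𝕄 is singular (rank deficient). -/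
open Matrix

/-- Lemma 3 of the paper: under the preconsistency condition `B𝟙 = 𝟙`, the vector
`v = (𝟙ᵀ, 𝟙ᵀ)ᵀ` annihilates the quadratic form of the test matrix
`𝕄 = [[GᵀZ + ZG − W, −GᵀZB], [−BᵀZG, W]]`; consequently, if `𝕄` is positive
semidefinite then `𝕄v = 0` and `𝕄` is singular. -/
theorem stmt2 (s : ℕ) (hs : 0 < s) (B G Z W : Matrix (Fin s) (Fin s) ℝ)
    (hB : B.mulVec (fun _ => 1) = fun _ => 1)
    (M : Matrix (Fin s ⊕ Fin s) (Fin s ⊕ Fin s) ℝ)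
    (hM : M = Matrix.fromBlocks (Gᵀ * Z + Z * G - W) (-(Gᵀ * Z * B)) (-(Bᵀ * Z * G)) W)
    (v : Fin s ⊕ Fin s → ℝ)
    (hv : v = Sum.elim (fun _ => 1) (fun _ => 1)) :
    v ⬝ᵥ M.mulVec v = 0 ∧ (M.PosSemidef → M.mulVec v = 0 ∧ ¬IsUnit M) := by
  subst hM hv
  have hquad : Sum.elim (fun _ => 1) (fun _ => 1) ⬝ᵥ
      (fromBlocks (Gᵀ * Z + Z * G - W) (-(Gᵀ * Z * B)) (-(Bᵀ * Z * G)) W).mulVec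
        (Sum.elim (fun _ => (1 : ℝ)) (fun _ => 1)) = 0 := by
    rw [fromBlocks_mulVec, sumElim_dotProduct_sumElim]
    simp only [Sum.elim_comp_inl, Sum.elim_comp_inr, add_mulVec, sub_mulVec, neg_mulVec,
      ← mulVec_mulVec, hB, dotProduct_add, dotProduct_sub, dotProduct_neg]
    rw [dotProduct_mulVec _ Bᵀ, vecMul_transpose, hB]
    ring
  refine ⟨hquad, fun hpos => ?_⟩
  have hker := (hpos.dotProduct_mulVec_zero_iff _).mp (by rwa [star_trivial])
  refine ⟨hker, fun hunit => ?_⟩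
  have hzero := mulVec_injective_of_isUnit hunit (hker.trans (mulVec_zero _).symm)
  simpa using congrFun hzero (Sum.inl ⟨0, hs⟩)
end

section
/- Let B, G be real s×s matrices and W, Z real symmetric positive definite s×s matrices such that the 2s×2s test matrix 𝕄 = [[GᵀZ + ZG − W, −GᵀZB], [−BᵀZG, W]] is positive definite. Then for every z ∈ ℂ with Re z < 0 such that I − zG is invertible, and every y ∈ ℂ^s, the vector u := (I − zG)^{-1}By satisfies u*Wu ≤ y*Wy. Equivalently, ‖W^{1/2}(I − zG)^{-1}B W^{-1/2}‖₂ ≤ 1 for all z with Re z < 0, i.e., the stability matrix M(z) = (I − zG)^{-1}B of the stiffly accurate peer method is contractive in the norm induced by W. -/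
open Matrix

/-- The quadratic form of a real matrix at a complex vector splits into the quadratic forms at
the real and imaginary parts. -/
theorem re_star_dotProduct_map_ofReal_mulVec {n : Type*} [Fintype n] (A : Matrix n n ℝ)
    (x : n → ℂ) :
    (star x ⬝ᵥ (A.map Complex.ofReal).mulVec x).re =
      (fun i => (x i).re) ⬝ᵥ A *ᵥ (fun i => (x i).re) +
        (fun i => (x i).im) ⬝ᵥ A *ᵥ (fun i => (x i).im) := by
  simp [dotProduct, mulVec, Complex.re_sum, Complex.im_sum, Finset.sum_add_distrib]

/-- The quadratic form of the test matrix, rewritten by means of the symmetry of `Z`. -/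
theorem dotProduct_mulVec_le_of_testMatrix_posSemidef {n : Type*} [Fintype n]
    {B G W Z : Matrix n n ℝ} (hZ : Z.IsSymm)
    (hM : (fromBlocks (Gᵀ * Z + Z * G - W) (-(Gᵀ * Z * B)) (-(Bᵀ * Z * G)) W).PosSemidef)
    (a c : n → ℝ) :
    a ⬝ᵥ W *ᵥ a ≤ c ⬝ᵥ W *ᵥ c + 2 * ((G *ᵥ a) ⬝ᵥ Z *ᵥ (a - B *ᵥ c)) := by
  have h := hM.dotProduct_mulVec_nonneg (Sum.elim a c)
  have hs (x y : n → ℝ) : x ⬝ᵥ Z *ᵥ y = y ⬝ᵥ Z *ᵥ x := by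
    rw [dotProduct_mulVec, ← mulVec_transpose, hZ.eq, dotProduct_comm]
  have ht (A : Matrix n n ℝ) (x y : n → ℝ) : x ⬝ᵥ Aᵀ *ᵥ y = (A *ᵥ x) ⬝ᵥ y := by
    rw [dotProduct_mulVec, vecMul_transpose]
  simp only [star_trivial, fromBlocks_mulVec, sumElim_dotProduct_sumElim, Sum.elim_comp_inl,
    Sum.elim_comp_inr, add_mulVec, sub_mulVec, neg_mulVec, dotProduct_add, dotProduct_sub,
    dotProduct_neg, ← mulVec_mulVec, ht] at h
  rw [hs a, hs (B *ᵥ c)] at h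
  rw [mulVec_sub, dotProduct_sub]
  linarith

/-- Lemma 4 of the paper: if `W, Z` are real symmetric positive definite and the test
matrix `𝕄 = [[GᵀZ + ZG − W, −GᵀZB], [−BᵀZG, W]]` is positive definite, then the
stability matrix `M(z) = (I − zG)⁻¹B` is contractive in the `W`-norm for every `z`
in the open left half-plane: `u*Wu ≤ y*Wy` for `u = (I − zG)⁻¹By`. -/
theorem stmt3 (s : ℕ) (B G W Z : Matrix (Fin s) (Fin s) ℝ)
    (hW : W.IsSymm) (hWpd : W.PosDef) (hZ : Z.IsSymm) (hZpd : Z.PosDef)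
    (hM : (Matrix.fromBlocks (Gᵀ * Z + Z * G - W) (-(Gᵀ * Z * B)) (-(Bᵀ * Z * G)) W).PosDef) :
    ∀ z : ℂ, z.re < 0 → IsUnit (1 - z • G.map Complex.ofReal) →
      ∀ (y u : Fin s → ℂ),
        u = (1 - z • G.map Complex.ofReal)⁻¹.mulVec ((B.map Complex.ofReal).mulVec y) →
        (star u ⬝ᵥ (W.map Complex.ofReal).mulVec u).re
          ≤ (star y ⬝ᵥ (W.map Complex.ofReal).mulVec y).re := by
  intro z hz hU y u hu
  have hsol : (1 - z • G.map Complex.ofReal) *ᵥ u = (B.map Complex.ofReal) *ᵥ y := by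
    rw [hu, mulVec_mulVec, mul_nonsing_inv _ ((isUnit_iff_isUnit_det _).mp hU), one_mulVec]
  set a : Fin s → ℝ := fun i => (u i).re with ha
  set b : Fin s → ℝ := fun i => (u i).im with hb
  set c : Fin s → ℝ := fun i => (y i).re with hc
  set d : Fin s → ℝ := fun i => (y i).im with hd
  rw [sub_mulVec, one_mulVec, smul_mulVec] at hsol
  have hre : a - B *ᵥ c = z.re • G *ᵥ a - z.im • G *ᵥ b := by
    ext i
    have h := congrArg Complex.re (congrFun hsol i)
    simp [mulVec, dotProduct, Complex.re_sum, Complex.im_sum] at h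
    simp [mulVec, dotProduct, ha, hb, hc]
    linarith
  have him : b - B *ᵥ d = z.re • G *ᵥ b + z.im • G *ᵥ a := by
    ext i
    have h := congrArg Complex.im (congrFun hsol i)
    simp [mulVec, dotProduct, Complex.re_sum, Complex.im_sum] at h
    simp [mulVec, dotProduct, ha, hb, hd]
    linarith
  have h₁ := dotProduct_mulVec_le_of_testMatrix_posSemidef hZ hM.posSemidef a c
  have h₂ := dotProduct_mulVec_le_of_testMatrix_posSemidef hZ hM.posSemidef b d
  have hs : (G *ᵥ a) ⬝ᵥ Z *ᵥ (G *ᵥ b) = (G *ᵥ b) ⬝ᵥ Z *ᵥ (G *ᵥ a) := by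
    rw [dotProduct_mulVec, ← mulVec_transpose, hZ.eq, dotProduct_comm]
  have hga := hZpd.posSemidef.dotProduct_mulVec_nonneg (G *ᵥ a)
  have hgb := hZpd.posSemidef.dotProduct_mulVec_nonneg (G *ᵥ b)
  rw [star_trivial] at hga hgb
  rw [hre, mulVec_sub, mulVec_smul, mulVec_smul, dotProduct_sub, dotProduct_smul, dotProduct_smul,
    smul_eq_mul, smul_eq_mul, hs] at h₁
  rw [him, mulVec_add, mulVec_smul, mulVec_smul, dotProduct_add, dotProduct_smul, dotProduct_smul,
    smul_eq_mul, smul_eq_mul] at h₂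
  rw [re_star_dotProduct_map_ofReal_mulVec, re_star_dotProduct_map_ofReal_mulVec]
  linarith [mul_nonpos_of_nonpos_of_nonneg hz.le hga, mul_nonpos_of_nonpos_of_nonneg hz.le hgb]
end

section
/- Let G, Z, W, E be real s×s matrices, let Θ be an invertible real s×s matrix, and set B := (I − GE)Θ and Ŵ := Θ^{-T}WΘ^{-1}. Then the congruence-type transformation of the test matrix 𝕄 = [[GᵀZ + ZG − W, −GᵀZB], [−BᵀZG, W]] satisfies the exact block identity [[I, Θ^{-T}], [0, Θ^{-T}]] · 𝕄 · [[I, 0], [Θ^{-1}, Θ^{-1}]] = [[(GᵀZG)E + Eᵀ(GᵀZG) + Ŵ − ΘᵀŴΘ, Ŵ − GᵀZ + (GᵀZG)E], [Ŵ − ZG + Eᵀ(GᵀZG), Ŵ]]. -/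
open Matrix

/-- Equation (18) of the paper: the rank-revealing congruence transformation of the
test matrix.  With `B = (I − GE)Θ` and `Ŵ = Θ⁻ᵀWΘ⁻¹` one has the exact block identity
`[[I, Θ⁻ᵀ], [0, Θ⁻ᵀ]] · 𝕄 · [[I, 0], [Θ⁻¹, Θ⁻¹]]
  = [[(GᵀZG)E + Eᵀ(GᵀZG) + Ŵ − ΘᵀŴΘ, Ŵ − GᵀZ + (GᵀZG)E], [Ŵ − ZG + Eᵀ(GᵀZG), Ŵ]]`. -/
theorem stmt4 (s : ℕ) (G Z W E Θ : Matrix (Fin s) (Fin s) ℝ) (hΘ : IsUnit Θ.det)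
    (B What : Matrix (Fin s) (Fin s) ℝ)
    (hB : B = (1 - G * E) * Θ) (hWhat : What = (Θᵀ)⁻¹ * W * Θ⁻¹) :
    Matrix.fromBlocks 1 (Θᵀ)⁻¹ 0 (Θᵀ)⁻¹
        * Matrix.fromBlocks (Gᵀ * Z + Z * G - W) (-(Gᵀ * Z * B)) (-(Bᵀ * Z * G)) W
        * Matrix.fromBlocks 1 0 Θ⁻¹ Θ⁻¹
      = Matrix.fromBlocks
          ((Gᵀ * Z * G) * E + Eᵀ * (Gᵀ * Z * G) + What - Θᵀ * What * Θ)
          (What - Gᵀ * Z + (Gᵀ * Z * G) * E)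
          (What - Z * G + Eᵀ * (Gᵀ * Z * G))
          What := by
  have hΘT : IsUnit Θᵀ.det := by rwa [Matrix.det_transpose]
  have hBr : B * Θ⁻¹ = 1 - G * E := by
    rw [hB, Matrix.mul_nonsing_inv_cancel_right _ _ hΘ]
  have hBl : (Θᵀ)⁻¹ * Bᵀ = 1 - Eᵀ * Gᵀ := by
    rw [hB, Matrix.transpose_mul, Matrix.nonsing_inv_mul_cancel_left _ _ hΘT,
      Matrix.transpose_sub, Matrix.transpose_one, Matrix.transpose_mul]
  have hW : Θᵀ * What * Θ = W := by
    rw [hWhat, Matrix.mul_assoc (Θᵀ)⁻¹, Matrix.mul_nonsing_inv_cancel_left _ _ hΘT,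
      Matrix.nonsing_inv_mul_cancel_right _ _ hΘ]
  have hr : Gᵀ * Z * B * Θ⁻¹ = Gᵀ * Z - Gᵀ * Z * G * E := by
    rw [Matrix.mul_assoc _ B, hBr]
    noncomm_ring
  have hl : (Θᵀ)⁻¹ * (Bᵀ * Z * G) = Z * G - Eᵀ * (Gᵀ * Z * G) := by
    rw [Matrix.mul_assoc Bᵀ, ← Matrix.mul_assoc, hBl]
    noncomm_ring
  rw [hW, Matrix.fromBlocks_multiply, Matrix.fromBlocks_multiply]
  simp only [Matrix.one_mul, Matrix.mul_one, Matrix.zero_mul, Matrix.mul_zero, zero_add,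
    Matrix.add_mul, Matrix.mul_neg, Matrix.neg_mul, hr, hl, ← hWhat]
  congr 1 <;> abel
end

section
/- Let s ≥ 1, let X be a real symmetric s×s matrix (indexed 1,…,s), and suppose U := XẼ + ẼᵀX is positive semidefinite, where Ẽ is the s×s matrix whose only nonzero entries are Ẽ_{i,i+1} = i for i = 1,…,s−1. Then U_{ij} = 0 whenever min{i, j} ≤ ⌊(s+1)/2⌋, and X_{ij} = 0 whenever i + j ≤ s. -/
open Matrix

/-- The matrix `Ẽ` (1-indexed: `Ẽ_{i,i+1} = i`, all other entries zero); in 0-indexed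
form the entry at `(i, i+1)` equals `i + 1`. -/
def Etil (s : ℕ) : Matrix (Fin s) (Fin s) ℝ :=
  Matrix.of fun i j => if (j : ℕ) = (i : ℕ) + 1 then ((i : ℕ) + 1 : ℝ) else 0

/-- A vanishing diagonal entry of a positive semidefinite matrix forces its row to vanish. -/
theorem Matrix.PosSemidef.apply_eq_zero_of_diag_eq_zero {n : Type*} [Fintype n] [DecidableEq n]
    {A : Matrix n n ℝ} (hA : A.PosSemidef) {i : n} (hi : A i i = 0) (j : n) : A i j = 0 := by
  have hcol : A *ᵥ Pi.single i 1 = 0 := by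
    rw [← hA.dotProduct_mulVec_zero_iff]
    simp [hi]
  have hji : A j i = 0 := by simpa using congrFun hcol j
  simpa [hji] using (hA.isHermitian.apply i j).symm

theorem mul_Etil_apply_zero {s : ℕ} (X : Matrix (Fin s) (Fin s) ℝ) (i : Fin s) (h : 0 < s) :
    (X * Etil s) i ⟨0, h⟩ = 0 := by
  simp [Matrix.mul_apply, Etil]

theorem mul_Etil_apply_succ {s : ℕ} (X : Matrix (Fin s) (Fin s) ℝ) (i : Fin s) (j : ℕ)
    (h : j + 1 < s) :
    (X * Etil s) i ⟨j + 1, h⟩ = (j + 1) * X i ⟨j, by omega⟩ := by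
  rw [Matrix.mul_apply, Finset.sum_eq_single ⟨j, by omega⟩]
  · simp [Etil, mul_comm]
  · intro b _ hb
    have hjb : j ≠ (b : ℕ) := fun e => hb (Fin.ext e.symm)
    simp [Etil, hjb]
  · simp

theorem mul_Etil_add_transpose_apply {s : ℕ} {X : Matrix (Fin s) (Fin s) ℝ} (hX : X.IsSymm)
    (i j : Fin s) :
    (X * Etil s + (Etil s)ᵀ * X) i j = (X * Etil s) i j + (X * Etil s) j i := by
  have h : (Etil s)ᵀ * X = (X * Etil s)ᵀ := by rw [Matrix.transpose_mul, hX.eq]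
  rw [h, Matrix.add_apply, Matrix.transpose_apply]

theorem row_eq_zero_of_posSemidef {s : ℕ} {X : Matrix (Fin s) (Fin s) ℝ} (hX : X.IsSymm)
    (hU : (X * Etil s + (Etil s)ᵀ * X).PosSemidef) (k : ℕ) (hk : 2 * k + 1 ≤ s) :
    (∀ j : Fin s, (X * Etil s + (Etil s)ᵀ * X) ⟨k, by omega⟩ j = 0) ∧
    (∀ j : Fin s, k + j + 2 ≤ s → X ⟨k, by omega⟩ j = 0) := by
  induction k with
  | zero =>
    have hrow := hU.apply_eq_zero_of_diag_eq_zero (i := ⟨0, by omega⟩) (by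
      rw [mul_Etil_add_transpose_apply hX, mul_Etil_apply_zero, add_zero])
    refine ⟨hrow, fun j hj => ?_⟩
    have h := hrow ⟨j + 1, by omega⟩
    rw [mul_Etil_add_transpose_apply hX, mul_Etil_apply_succ, mul_Etil_apply_zero, add_zero] at h
    exact (mul_eq_zero.mp h).resolve_left (by positivity)
  | succ k ih =>
    obtain ⟨-, ih⟩ := ih (by omega)
    have hzero (j : Fin s) (hj : k + j + 2 ≤ s) : (X * Etil s) j ⟨k + 1, by omega⟩ = 0 := by
      rw [mul_Etil_apply_succ, hX.apply, ih j hj, mul_zero]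
    have hrow := hU.apply_eq_zero_of_diag_eq_zero (i := ⟨k + 1, by omega⟩) (by
      rw [mul_Etil_add_transpose_apply hX, hzero _ (by dsimp only; omega), add_zero])
    refine ⟨hrow, fun j hj => ?_⟩
    have h := hrow ⟨j + 1, by omega⟩
    rw [mul_Etil_add_transpose_apply hX, hzero _ (by dsimp only; omega), mul_Etil_apply_succ,
      add_zero] at h
    exact (mul_eq_zero.mp h).resolve_left (by positivity)

/-- Lemma 6 of the paper: if `X` is symmetric and `U = XẼ + ẼᵀX` is positive
semidefinite, then `U_{ij} = 0` whenever `min{i,j} ≤ ⌊(s+1)/2⌋` and `X_{ij} = 0`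
whenever `i + j ≤ s` (1-indexed). -/
theorem stmt11 (s : ℕ) (hs : 1 ≤ s) (X : Matrix (Fin s) (Fin s) ℝ) (hX : X.IsSymm)
    (hU : (X * Etil s + (Etil s)ᵀ * X).PosSemidef) :
    (∀ i j : Fin s, min ((i : ℕ) + 1) ((j : ℕ) + 1) ≤ (s + 1) / 2 →
      (X * Etil s + (Etil s)ᵀ * X) i j = 0) ∧
    (∀ i j : Fin s, ((i : ℕ) + 1) + ((j : ℕ) + 1) ≤ s → X i j = 0) := by
  constructor
  · intro i j hij
    rcases min_le_iff.mp hij with h | h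
    · exact (row_eq_zero_of_posSemidef hX hU i (by omega)).1 j
    · rw [mul_Etil_add_transpose_apply hX, add_comm, ← mul_Etil_add_transpose_apply hX]
      exact (row_eq_zero_of_posSemidef hX hU j (by omega)).1 i
  · intro i j hij
    rcases le_total (i : ℕ) j with h | h
    · exact (row_eq_zero_of_posSemidef hX hU i (by omega)).2 j (by omega)
    · rw [← hX.apply]
      exact (row_eq_zero_of_posSemidef hX hU j (by omega)).2 i (by omega)
end

section
/- Let s ≥ 1 and let Ẽ be the s×s matrix whose only nonzero entries are Ẽ_{i,i+1} = i for i = 1,…,s−1. The real vector space {X ∈ ℝ^{s×s} : Xᵀ = X and XẼ + ẼᵀX = 0} (the kernel of the map L_Ẽ on symmetric matrices) has dimension ⌊(s+1)/2⌋. -/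
open Matrix

/-- The kernel of the map `L_Ẽ : X ↦ XẼ + ẼᵀX` on symmetric matrices, as a real
subspace of the space of real `s×s` matrices. -/
def kerLE (s : ℕ) : Submodule ℝ (Matrix (Fin s) (Fin s) ℝ) where
  carrier := {X | Xᵀ = X ∧ X * Etil s + (Etil s)ᵀ * X = 0}
  zero_mem' := by constructor <;> simp
  add_mem' := by
    rintro a b ⟨ha1, ha2⟩ ⟨hb1, hb2⟩
    refine ⟨by simp [Matrix.transpose_add, ha1, hb1], ?_⟩
    have h : (a + b) * Etil s + (Etil s)ᵀ * (a + b)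
        = (a * Etil s + (Etil s)ᵀ * a) + (b * Etil s + (Etil s)ᵀ * b) := by
      noncomm_ring
    rw [h, ha2, hb2, add_zero]
  smul_mem' := by
    rintro c a ⟨ha1, ha2⟩
    refine ⟨by simp [Matrix.transpose_smul, ha1], ?_⟩
    have h : (c • a) * Etil s + (Etil s)ᵀ * (c • a)
        = c • (a * Etil s + (Etil s)ᵀ * a) := by
      simp [Matrix.smul_mul, Matrix.mul_smul, smul_add]
    rw [h, ha2, smul_zero]

/-- The defining equation of `kerLE`, read entrywise. -/
theorem mem_kerLE_iff {n : ℕ} {X : Matrix (Fin (n + 1)) (Fin (n + 1)) ℝ} :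
    X ∈ kerLE (n + 1) ↔ Xᵀ = X ∧ (∀ j : Fin n, X 0 j.castSucc = 0) ∧
      ∀ i j : Fin n, ((j : ℕ) + 1 : ℝ) * X i.succ j.castSucc
        + ((i : ℕ) + 1 : ℝ) * X i.castSucc j.succ = 0 := by
  have mul_zero_col : ∀ (Y : Matrix (Fin (n + 1)) (Fin (n + 1)) ℝ) i,
      (Y * Etil (n + 1)) i 0 = 0 := by
    intro Y i
    simp [Matrix.mul_apply, Etil]
  have mul_succ_col : ∀ (Y : Matrix (Fin (n + 1)) (Fin (n + 1)) ℝ) i (j : Fin n),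
      (Y * Etil (n + 1)) i j.succ = ((j : ℕ) + 1 : ℝ) * Y i j.castSucc := by
    intro Y i j
    rw [Matrix.mul_apply, Finset.sum_eq_single j.castSucc]
    · simp [Etil, mul_comm]
    · intro k _ hk
      have : (j : ℕ) ≠ k := fun h => hk (Fin.ext h.symm)
      simp [Etil, this]
    · simp
  have mul_transpose : ∀ i j, ((Etil (n + 1))ᵀ * X) i j = (Xᵀ * Etil (n + 1)) j i := by
    intro i j
    rw [← Matrix.transpose_apply (Xᵀ * Etil (n + 1)), Matrix.transpose_mul,
      Matrix.transpose_transpose]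
  change (Xᵀ = X ∧ X * Etil (n + 1) + (Etil (n + 1))ᵀ * X = 0) ↔ _
  refine and_congr_right fun hX => ?_
  have hsymm : ∀ i j, X i j = X j i := fun i j => by
    conv_lhs => rw [← hX, Matrix.transpose_apply]
  have hne : ∀ j : Fin n, ((j : ℕ) + 1 : ℝ) ≠ 0 := fun j => by positivity
  rw [← Matrix.ext_iff]
  simp only [Matrix.add_apply, Matrix.zero_apply, mul_transpose, hX, Fin.forall_fin_succ,
    mul_zero_col, mul_succ_col, add_zero, zero_add, mul_eq_zero, hne, false_or, true_and,
    forall_and]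
  refine ⟨fun h => ⟨h.1, fun i j => ?_⟩, fun h => ⟨h.1, h.1, fun i j => ?_⟩⟩
  · rw [hsymm i.castSucc j.succ]
    exact h.2.2 i j
  · rw [hsymm j.succ i.castSucc]
    exact h.2 i j

/-- An element of the kernel alternates in sign, up to factorials, along antidiagonals. -/
theorem kerLE_antidiagonal {n : ℕ} {X : Matrix (Fin (n + 1)) (Fin (n + 1)) ℝ}
    (hX : X ∈ kerLE (n + 1)) (m a b : ℕ) (ha : a + m < n + 1) (hb : b + m < n + 1) :
    X ⟨a, by omega⟩ ⟨b + m, hb⟩ * ((a + m).factorial * b.factorial)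
      = (-1) ^ m * X ⟨a + m, ha⟩ ⟨b, by omega⟩ * (a.factorial * (b + m).factorial) := by
  induction m generalizing a with
  | zero => simp
  | succ m ih =>
    have h := (mem_kerLE_iff.1 hX).2.2 ⟨a, by omega⟩ ⟨b + m, by omega⟩
    simp only [Fin.succ_mk, Fin.castSucc_mk] at h
    have h' := ih (a + 1) (by omega) (by omega)
    have key : a + 1 + m = a + (m + 1) := by ring
    simp only [key] at h'
    simp only [← add_assoc b m 1, Nat.factorial_succ (b + m), Nat.factorial_succ a] at h h' ⊢
    have ha1 : (a + 1 : ℝ) ≠ 0 := by positivity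
    push_cast at h h' ⊢
    apply mul_left_cancel₀ ha1
    rw [pow_succ]
    linear_combination ((a + (m + 1)).factorial * b.factorial : ℝ) * h - ((b : ℝ) + m + 1) * h'

/-- An element of the kernel is determined by every other entry of its last row, counted from
the diagonal. -/
theorem kerLE_eq_zero_of_last_row {n : ℕ} {X : Matrix (Fin (n + 1)) (Fin (n + 1)) ℝ}
    (hX : X ∈ kerLE (n + 1))
    (h : ∀ k : Fin (n + 1), Even (n + k : ℕ) → X (Fin.last n) k = 0) : X = 0 := by
  obtain ⟨hT, hzero, hrec⟩ := mem_kerLE_iff.1 hX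
  have hsymm : ∀ i j, X i j = X j i := fun i j => by
    conv_lhs => rw [← hT, Matrix.transpose_apply]
  have hlast : ∀ k, X (Fin.last n) k = 0 := by
    intro k
    rcases Nat.even_or_odd (n + k : ℕ) with hk | hk
    · exact h k hk
    · obtain ⟨m, hm⟩ : ∃ m, (k : ℕ) + m = n := ⟨n - k, by omega⟩
      have hodd : Odd m := by grind
      have h1 := kerLE_antidiagonal hX m k k (by omega) (by omega)
      have e1 : (⟨k + m, by omega⟩ : Fin (n + 1)) = Fin.last n := Fin.ext hm
      rw [e1, Fin.eta, hsymm k, hodd.neg_one_pow] at h1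
      have hpos : ((k + m : ℕ).factorial * (k : ℕ).factorial : ℝ) ≠ 0 := by positivity
      have h2 : X (Fin.last n) k * ((k + m : ℕ).factorial * (k : ℕ).factorial : ℝ) = 0 := by
        linarith
      exact (mul_eq_zero.1 h2).resolve_right hpos
  ext i j
  induction i using Fin.reverseInduction generalizing j with
  | last => exact hlast j
  | cast i ih =>
    cases j using Fin.cases with
    | zero => rw [hsymm, hzero]; rfl
    | succ j =>
      have h1 := hrec i j
      rw [ih, Matrix.zero_apply, mul_zero, zero_add] at h1
      exact (mul_eq_zero.1 h1).resolve_left (by positivity)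

/-- The matrix with entries `(-1)^i i! j! c (i + j)`. -/
noncomputable def antidiagonalMatrix (n : ℕ) (c : ℕ → ℝ) :
    Matrix (Fin (n + 1)) (Fin (n + 1)) ℝ :=
  Matrix.of fun i j => (-1) ^ (i : ℕ) * ((i : ℕ).factorial * (j : ℕ).factorial) * c (i + j)

theorem antidiagonalMatrix_mem_kerLE {n : ℕ} {c : ℕ → ℝ} (hlt : ∀ k < n, c k = 0)
    (hodd : ∀ k, Odd k → c k = 0) : antidiagonalMatrix n c ∈ kerLE (n + 1) := by
  refine mem_kerLE_iff.2 ⟨?_, fun j => ?_, fun i j => ?_⟩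
  · ext i j
    simp only [antidiagonalMatrix, Matrix.transpose_apply, Matrix.of_apply]
    rcases Nat.even_or_odd (i + j : ℕ) with h | h
    · have : (-1 : ℝ) ^ (j : ℕ) = (-1) ^ (i : ℕ) := by
        rw [neg_one_pow_eq_pow_mod_two, neg_one_pow_eq_pow_mod_two (n := (i : ℕ))]
        congr 1
        grind
      rw [this, add_comm (j : ℕ)]
      ring
    · rw [hodd _ h, add_comm (j : ℕ), hodd _ h, mul_zero, mul_zero]
  · simp [antidiagonalMatrix, hlt]
  · simp only [antidiagonalMatrix, Matrix.of_apply, Fin.val_succ, Fin.val_castSucc,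
      Nat.factorial_succ, pow_succ, add_right_comm (i : ℕ) 1, ← add_assoc]
    push_cast
    ring

/-- Every other entry of the last row, starting from the diagonal, as a linear map on the
kernel. -/
def kerLELastRow (n : ℕ) : kerLE (n + 1) →ₗ[ℝ] (Fin ((n + 1 + 1) / 2) → ℝ) where
  toFun X t := X.1 (Fin.last n) ⟨n - 2 * t, by omega⟩
  map_add' _ _ := rfl
  map_smul' _ _ := rfl

theorem kerLELastRow_apply {n : ℕ} (X : kerLE (n + 1)) (t : Fin ((n + 1 + 1) / 2)) :
    kerLELastRow n X t = X.1 (Fin.last n) ⟨n - 2 * t, by omega⟩ := rfl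

theorem kerLELastRow_injective (n : ℕ) : Function.Injective (kerLELastRow n) := by
  rw [injective_iff_map_eq_zero]
  intro X hX
  refine Subtype.ext (kerLE_eq_zero_of_last_row X.2 fun k hk => ?_)
  have h := congrFun hX ⟨(n - k) / 2, by omega⟩
  have hk' : (⟨n - 2 * ((n - k) / 2), by omega⟩ : Fin (n + 1)) = k :=
    Fin.ext (by have := k.2; simp only; grind)
  rwa [kerLELastRow_apply, hk'] at h

theorem kerLELastRow_surjective (n : ℕ) : Function.Surjective (kerLELastRow n) := by
  intro v
  let c : ℕ → ℝ := fun k =>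
    if h : n ≤ k ∧ Even k then
      v ⟨n - k / 2, by obtain ⟨h, r, rfl⟩ := h; omega⟩
        / ((-1) ^ n * (n.factorial * (k - n).factorial))
    else 0
  refine ⟨⟨antidiagonalMatrix n c, antidiagonalMatrix_mem_kerLE (fun k hk => ?_)
    fun k hk => ?_⟩, ?_⟩
  · exact dif_neg fun h => absurd h.1 (by omega)
  · exact dif_neg fun h => (Nat.not_even_iff_odd.2 hk) h.2
  · ext t
    have ht := t.2
    have hc : n ≤ n + (n - 2 * (t : ℕ)) ∧ Even (n + (n - 2 * (t : ℕ))) :=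
      ⟨by omega, n - t, by omega⟩
    have hidx : n - (n + (n - 2 * (t : ℕ))) / 2 = t := by omega
    have hpos : ((-1 : ℝ) ^ n * (n.factorial * (n - 2 * (t : ℕ)).factorial)) ≠ 0 :=
      mul_ne_zero (pow_ne_zero _ (by norm_num)) (by positivity)
    rw [kerLELastRow_apply]
    simp only [antidiagonalMatrix, Matrix.of_apply, Fin.val_last, c, dif_pos hc, hidx, Nat.add_sub_cancel_left]
    exact mul_div_cancel₀ _ hpos

/-- Lemma 7 of the paper: the kernel of `L_Ẽ` on symmetric matrices has dimension
`⌊(s+1)/2⌋`. -/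
theorem stmt12 (s : ℕ) (hs : 1 ≤ s) : Module.finrank ℝ (kerLE s) = (s + 1) / 2 := by
  obtain ⟨n, rfl⟩ : ∃ n, s = n + 1 := ⟨s - 1, by omega⟩
  rw [(LinearEquiv.ofBijective (kerLELastRow n)
    ⟨kerLELastRow_injective n, kerLELastRow_surjective n⟩).finrank_eq]
  simp
end

section
/- Every non-defective matrix A ∈ ℂ^{s×s} possesses a triangular canonical form: if A is diagonalizable, i.e., there exist an invertible X ∈ ℂ^{s×s} and a diagonal J ∈ ℂ^{s×s} with A = XJX^{-1}, then there exist an invertible upper triangular matrix U_A ∈ ℂ^{s×s} and a lower triangular matrix L_A ∈ ℂ^{s×s} such that A = U_A L_A U_A^{-1}. -/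
open Matrix

/-- The columns of `A` modulo the line spanned by a vector `v` with nonzero last entry, in the
coordinates given by the first `n` standard basis vectors. -/
def Matrix.deflate {K : Type*} [Field K] {n m : ℕ}
    (A : Matrix (Fin (n + 1)) (Fin m) K) (v : Fin (n + 1) → K) : Matrix (Fin n) (Fin m) K :=
  Matrix.of fun i j => A i.castSucc j - v i.castSucc / v (Fin.last n) * A (Fin.last n) j

/-- If no nontrivial combination of the columns of `X` vanishes, the same holds for the columns
other than the `k`-th one modulo the `k`-th one. -/
theorem Matrix.det_deflate_ne_zero {K : Type*} [Field K] {n : ℕ}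
    {X : Matrix (Fin (n + 1)) (Fin (n + 1)) K} (hX : X.det ≠ 0) {k : Fin (n + 1)}
    (hk : X (Fin.last n) k ≠ 0) :
    ((X.submatrix id k.succAbove).deflate (X.col k)).det ≠ 0 := by
  intro hdet
  obtain ⟨z, hz, hYz⟩ := Matrix.exists_mulVec_eq_zero_iff.mpr hdet
  set t : K := -(∑ j, X (Fin.last n) (k.succAbove j) * z j) / X (Fin.last n) k with ht
  have hXz : X *ᵥ (k.insertNth t z : Fin (n + 1) → K) = 0 := by
    ext i
    simp only [Matrix.mulVec, dotProduct, Fin.sum_univ_succAbove _ k, Fin.insertNth_apply_same,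
      Fin.insertNth_apply_succAbove, Pi.zero_apply]
    induction i using Fin.lastCases with
    | last => rw [ht]; field_simp; ring
    | cast i =>
      have h := congrFun hYz i
      simp only [Matrix.mulVec, dotProduct, Matrix.deflate, Matrix.of_apply, Matrix.submatrix_apply,
        id, Matrix.col_apply, sub_mul, Finset.sum_sub_distrib, mul_assoc, ← Finset.mul_sum,
        Pi.zero_apply] at h
      rw [ht]
      linear_combination h
  have h0 := Matrix.eq_zero_of_mulVec_eq_zero hX hXz
  apply hz
  ext j
  simpa using congrFun h0 (k.succAbove j)

/-- Deflation preserves a full system of eigenvectors. -/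
theorem Matrix.deflate_mul_deflate {K : Type*} [Field K] {n : ℕ}
    {A X : Matrix (Fin (n + 1)) (Fin (n + 1)) K} {d : Fin (n + 1) → K}
    (hAX : A * X = X * Matrix.diagonal d) {k : Fin (n + 1)} (hk : X (Fin.last n) k ≠ 0) :
    (A.submatrix id Fin.castSucc).deflate (X.col k) *
        (X.submatrix id k.succAbove).deflate (X.col k) =
      (X.submatrix id k.succAbove).deflate (X.col k) * Matrix.diagonal (d ∘ k.succAbove) := by
  have hcol (i j : Fin (n + 1)) :
      ∑ m : Fin n, A i m.castSucc * X m.castSucc j + A i (Fin.last n) * X (Fin.last n) j =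
        X i j * d j := by
    rw [← Matrix.mul_diagonal, ← hAX, Matrix.mul_apply, Fin.sum_univ_castSucc]
  ext i j
  rw [Matrix.mul_diagonal, Matrix.mul_apply]
  simp only [Matrix.deflate, Matrix.of_apply, Matrix.submatrix_apply, id, Matrix.col_apply,
    Function.comp_apply]
  set c := X (Fin.last n) k
  set q := X i.castSucc k / c with hq
  set r := X (Fin.last n) (k.succAbove j) / c with hr
  have hqc : q * c = X i.castSucc k := div_mul_cancel₀ _ hk
  have hrc : r * c = X (Fin.last n) (k.succAbove j) := div_mul_cancel₀ _ hk
  have hsum : ∑ m : Fin n, (A i.castSucc m.castSucc - q * A (Fin.last n) m.castSucc) *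
      (X m.castSucc (k.succAbove j) - X m.castSucc k / c * X (Fin.last n) (k.succAbove j)) =
      (∑ m : Fin n, A i.castSucc m.castSucc * X m.castSucc (k.succAbove j)
        - q * ∑ m : Fin n, A (Fin.last n) m.castSucc * X m.castSucc (k.succAbove j))
      - r * (∑ m : Fin n, A i.castSucc m.castSucc * X m.castSucc k
        - q * ∑ m : Fin n, A (Fin.last n) m.castSucc * X m.castSucc k) := by
    simp only [Finset.mul_sum, ← Finset.sum_sub_distrib]
    refine Finset.sum_congr rfl fun m _ => ?_
    rw [hr]
    ring
  rw [hsum]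
  linear_combination hcol i.castSucc (k.succAbove j) - q * hcol (Fin.last n) (k.succAbove j)
    - r * hcol i.castSucc k + r * q * hcol (Fin.last n) k
    + (A i.castSucc (Fin.last n) - q * A (Fin.last n) (Fin.last n)) * hrc
    + r * d k * hqc

/-- A matrix with a full system of eigenvectors is conjugate to a lower triangular matrix by an
upper triangular one. -/
theorem exists_upper_conj_lower {K : Type*} [Field K] (n : ℕ) (A X : Matrix (Fin n) (Fin n) K)
    (d : Fin n → K) (hX : X.det ≠ 0) (hAX : A * X = X * Matrix.diagonal d) :
    ∃ U L : Matrix (Fin n) (Fin n) K, U.det ≠ 0 ∧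
      (∀ i j : Fin n, j < i → U i j = 0) ∧
      (∀ i j : Fin n, i < j → L i j = 0) ∧
      A * U = U * L := by
  induction n with
  | zero => exact ⟨1, 1, by simp, fun i => i.elim0, fun i => i.elim0, Subsingleton.elim _ _⟩
  | succ n ih =>
    obtain ⟨k, hk⟩ : ∃ k, X (Fin.last n) k ≠ 0 := by
      by_contra! h
      exact hX (Matrix.det_eq_zero_of_row_eq_zero _ h)
    obtain ⟨U, L, hU, hup, hlow, hUL⟩ := ih _ _ _ (Matrix.det_deflate_ne_zero hX hk)
      (Matrix.deflate_mul_deflate hAX hk)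
    let V : Matrix (Fin (n + 1)) (Fin (n + 1)) K := Matrix.of fun i j =>
      Fin.lastCases (motive := fun _ => K) (X i k)
        (fun j' => Fin.lastCases (motive := fun _ => K) 0 (fun i' => U i' j') i) j
    let M : Matrix (Fin (n + 1)) (Fin (n + 1)) K := Matrix.of fun i j =>
      Fin.lastCases (motive := fun _ => K)
        (Fin.lastCases (motive := fun _ => K) (d k) (fun _ => 0) i)
        (fun j' => Fin.lastCases (motive := fun _ => K)
          ((∑ m : Fin n, A (Fin.last n) m.castSucc * U m j') / X (Fin.last n) k)
          (fun i' => L i' j') i) j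
    have hVup (i j : Fin (n + 1)) (hij : j < i) : V i j = 0 := by
      induction j using Fin.lastCases with
      | last => exact absurd hij (Fin.le_last i).not_gt
      | cast j =>
        induction i using Fin.lastCases with
        | last => simp [V]
        | cast i => simpa [V] using hup i j (by simpa using hij)
    refine ⟨V, M, ?_, hVup, fun i j hij => ?_, ?_⟩
    · rw [Matrix.det_of_isUpperTriangular fun i j => hVup i j]
      rw [Matrix.det_of_isUpperTriangular fun i j => hup i j] at hU
      rw [Fin.prod_univ_castSucc]
      simpa [V] using ⟨hU, hk⟩
    · induction i using Fin.lastCases with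
      | last => exact absurd hij (Fin.le_last j).not_gt
      | cast i =>
        induction j using Fin.lastCases with
        | last => simp [M]
        | cast j => simpa [M] using hlow i j (by simpa using hij)
    · ext i j
      rw [Matrix.mul_apply, Matrix.mul_apply]
      induction j using Fin.lastCases with
      | last =>
        have h := congrFun₂ hAX i k
        rw [Matrix.mul_diagonal, Matrix.mul_apply] at h
        rw [Fin.sum_univ_castSucc (fun m => V i m * M m (Fin.last n))]
        simpa [V, M] using h
      | cast j =>
        induction i using Fin.lastCases with
        | last =>
          simp only [Fin.sum_univ_castSucc]
          simp [V, M, mul_div_cancel₀, hk]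
        | cast i =>
          have h := congrFun₂ hUL i j
          simp only [Matrix.mul_apply, Matrix.deflate, Matrix.of_apply, Matrix.submatrix_apply, id,
            Matrix.col_apply, sub_mul, Finset.sum_sub_distrib, mul_assoc, ← Finset.mul_sum] at h
          simp only [Fin.sum_univ_castSucc]
          simp only [V, M, Matrix.of_apply, Fin.lastCases_castSucc, Fin.lastCases_last, mul_zero,
            add_zero]
          linear_combination h

/-- Lemma 11 of the paper: every non-defective (diagonalizable) matrix `A ∈ ℂ^{s×s}`
possesses a triangular canonical form `A = U_A L_A U_A⁻¹` with `U_A` invertible upper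
triangular and `L_A` lower triangular. -/
theorem stmt18 (s : ℕ) (A : Matrix (Fin s) (Fin s) ℂ)
    (h : ∃ (X : Matrix (Fin s) (Fin s) ℂ) (d : Fin s → ℂ),
      IsUnit X.det ∧ A = X * Matrix.diagonal d * X⁻¹) :
    ∃ U L : Matrix (Fin s) (Fin s) ℂ, IsUnit U.det ∧
      (∀ i j : Fin s, j < i → U i j = 0) ∧
      (∀ i j : Fin s, i < j → L i j = 0) ∧
      A = U * L * U⁻¹ := by
  obtain ⟨X, d, hX, rfl⟩ := h
  obtain ⟨U, L, hU, hup, hlow, hUL⟩ :=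
    exists_upper_conj_lower s (X * Matrix.diagonal d * X⁻¹) X d hX.ne_zero
      (Matrix.nonsing_inv_mul_cancel_right _ _ hX)
  refine ⟨U, L, hU.isUnit, hup, hlow, ?_⟩
  rw [← hUL, Matrix.mul_nonsing_inv_cancel_right _ _ hU.isUnit]
end
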